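/- Let s > 0 and let μ be a Radon measure on (ℍ^n, d_H) such that the set of points x where Θ^s(μ,x) = lim_{r→0⁺} μ(B(x,r))/r^s exists and is positive and finite has positive μ-measure. Then there exists a nonzero s-uniform Radon measure ν on (ℍ^n, d_H), i.e. a nonzero Radon measure ν and a constant c > 0 with ν(B(x,r)) = c·r^s for all x ∈ supp(ν) and all r > 0. -/

import Mathlib

open MeasureTheory Set Filter ENNReal NNReal

noncomputable section

/-- The underlying space of the Heisenberg group `ℍⁿ = ℝ²ⁿ × ℝ`. -/
abbrev Heis (n : ℕ) := EuclideanSpace ℝ (Fin (2 * n)) × ℝ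

/-- The symplectic form `A(x',y') = -2 ∑ (x_j y_{j+n} - x_{j+n} y_j)` on `ℝ²ⁿ`. -/
def symp {n : ℕ} (x y : EuclideanSpace ℝ (Fin (2 * n))) : ℝ :=
  -2 * ∑ j : Fin n,
    (x ⟨j.1, by have := j.isLt; omega⟩ * y ⟨j.1 + n, by have := j.isLt; omega⟩ -
     x ⟨j.1 + n, by have := j.isLt; omega⟩ * y ⟨j.1, by have := j.isLt; omega⟩)

/-- The Heisenberg group multiplication. -/
def hmul {n : ℕ} (x y : Heis n) : Heis n := (x.1 + y.1, x.2 + y.2 + symp x.1 y.1)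

/-- The Heisenberg group inverse, `x⁻¹ = -x`. -/
def hinv {n : ℕ} (x : Heis n) : Heis n := (-x.1, -x.2)

/-- The identity element `e = 0`. -/
def eH {n : ℕ} : Heis n := (0, 0)

/-- The Korányi norm `‖x‖_H = (|x'|⁴ + x_{2n+1}²)^{1/4}`. -/
def KNorm {n : ℕ} (x : Heis n) : ℝ := (‖x.1‖ ^ 4 + x.2 ^ 2) ^ ((1 : ℝ) / 4)

/-- The Korányi metric `d_H(x,y) = ‖x⁻¹·y‖_H`. -/
def dH {n : ℕ} (x y : Heis n) : ℝ := KNorm (hmul (hinv x) y)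

/-- The closed `d_H`-ball of center `x` and radius `r`. -/
def ballH {n : ℕ} (x : Heis n) (r : ℝ) : Set (Heis n) := {y | dH x y ≤ r}

/-- The support of a measure with respect to the Korányi metric. -/
def suppH {n : ℕ} (μ : Measure (Heis n)) : Set (Heis n) := {x | ∀ r > 0, 0 < μ (ballH x r)}

/-- A Radon measure is uniformly distributed if all balls centered on its support of
a common radius have the same measure. -/
def UniformlyDistributed {n : ℕ} (μ : Measure (Heis n)) : Prop :=
  ∀ x ∈ suppH μ, ∀ y ∈ suppH μ, ∀ r : ℝ, 0 < r → μ (ballH x r) = μ (ballH y r)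

/-- The dilations `δ_r(x', x_{2n+1}) = (r x', r² x_{2n+1})`. -/
def dil {n : ℕ} (r : ℝ) (x : Heis n) : Heis n := (r • x.1, r ^ 2 * x.2)

/-- `d_H`-diameter of a set, as an extended real. -/
def ediamH {n : ℕ} (E : Set (Heis n)) : ℝ≥0∞ :=
  ⨆ x ∈ E, ⨆ y ∈ E, ENNReal.ofReal (dH x y)

/-- The `s`-dimensional Hausdorff measure built from the Korányi metric `d_H`. -/
def hausH {n : ℕ} (s : ℝ) (E : Set (Heis n)) : ℝ≥0∞ :=
  ⨆ (δ : ℝ) (_ : 0 < δ), ⨅ (t : ℕ → Set (Heis n)) (_ : E ⊆ ⋃ i, t i)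
    (_ : ∀ i, ediamH (t i) ≤ ENNReal.ofReal δ), ∑' i, ediamH (t i) ^ s

/-- The Hausdorff dimension with respect to the Korányi metric `d_H`. -/
def dimHH {n : ℕ} (E : Set (Heis n)) : ℝ≥0∞ :=
  ⨆ (d : ℝ≥0) (_ : hausH (d : ℝ) E = ⊤), (d : ℝ≥0∞)

/-- `Θˢ(μ,x) = d`: the `s`-density of `μ` at `x` exists and equals `d`. -/
def HasDensity {n : ℕ} (μ : Measure (Heis n)) (s : ℝ) (x : Heis n) (d : ℝ≥0∞) : Prop :=
  Tendsto (fun r : ℝ => μ (ballH x r) / ENNReal.ofReal (r ^ s)) (nhdsWithin 0 (Ioi 0)) (nhds d)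

/-! ### Geometry of the Korányi metric -/

lemma sum_two_mul {n : ℕ} (f : Fin (2 * n) → ℝ) :
    ∑ i, f i = ∑ j : Fin n, (f ⟨j.1, by have := j.isLt; omega⟩ +
      f ⟨j.1 + n, by have := j.isLt; omega⟩) := by
  rw [← (finCongr (two_mul n).symm).sum_comp f, Fin.sum_univ_add, ← Finset.sum_add_distrib]
  refine Finset.sum_congr rfl fun j _ => ?_
  congr 2
  apply Fin.ext
  simp [add_comm]

lemma real_cs {n : ℕ} (a b c d : Fin n → ℝ) :
    (∑ j, (a j * c j + b j * d j)) ^ 2 + (∑ j, (a j * d j - b j * c j)) ^ 2 ≤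
      (∑ j, (a j ^ 2 + b j ^ 2)) * ∑ j, (c j ^ 2 + d j ^ 2) := by
  set p := ∑ j, (a j * c j + b j * d j) with hp
  set q := ∑ j, (a j * d j - b j * c j) with hq
  set P := ∑ j, (a j ^ 2 + b j ^ 2) with hP
  set Q := ∑ j, (c j ^ 2 + d j ^ 2) with hQ
  have hQ0 : 0 ≤ Q := Finset.sum_nonneg fun j _ => by positivity
  have key : ∑ j, ((Q * a j - p * c j - q * d j) ^ 2 + (Q * b j - p * d j + q * c j) ^ 2)
      = Q * (Q * P - p ^ 2 - q ^ 2) := by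
    have : ∀ j, ((Q * a j - p * c j - q * d j) ^ 2 + (Q * b j - p * d j + q * c j) ^ 2)
      = Q ^ 2 * (a j ^ 2 + b j ^ 2) - 2 * Q * p * (a j * c j + b j * d j)
        - 2 * Q * q * (a j * d j - b j * c j) + (p ^ 2 + q ^ 2) * (c j ^ 2 + d j ^ 2) := by
      intro j; ring
    simp only [this, Finset.sum_add_distrib, Finset.sum_sub_distrib, ← Finset.mul_sum]
    simp only [Finset.sum_add_distrib, Finset.sum_sub_distrib] at hp hq hP hQ
    rw [← hP, ← hQ, ← hp, ← hq]
    ring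
  have key0 : 0 ≤ Q * (Q * P - p ^ 2 - q ^ 2) := by
    rw [← key]; exact Finset.sum_nonneg fun j _ => by positivity
  rcases hQ0.eq_or_lt with h | h
  · have hz : ∀ j, c j ^ 2 + d j ^ 2 = 0 := by
      intro j
      exact (Finset.sum_eq_zero_iff_of_nonneg (fun j _ => by positivity)).1 (hQ ▸ h.symm) j
        (Finset.mem_univ j)
    have hc : ∀ j, c j = 0 := fun j => by nlinarith [hz j, sq_nonneg (c j), sq_nonneg (d j)]
    have hd : ∀ j, d j = 0 := fun j => by nlinarith [hz j, sq_nonneg (c j), sq_nonneg (d j)]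
    have p0 : p = 0 := by simp [hp, hc, hd]
    have q0 : q = 0 := by simp [hq, hc, hd]
    rw [p0, q0, ← h]; simp
  · have := nonneg_of_mul_nonneg_right key0 h
    linarith

lemma symp_cs {n : ℕ} (x y : EuclideanSpace ℝ (Fin (2 * n))) :
    (inner ℝ x y) ^ 2 + (symp x y / 2) ^ 2 ≤ ‖x‖ ^ 2 * ‖y‖ ^ 2 := by
  have h := real_cs (fun j : Fin n => x ⟨j.1, by have := j.isLt; omega⟩)
    (fun j : Fin n => x ⟨j.1 + n, by have := j.isLt; omega⟩)
    (fun j : Fin n => y ⟨j.1, by have := j.isLt; omega⟩)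
    (fun j : Fin n => y ⟨j.1 + n, by have := j.isLt; omega⟩)
  have e1 : (inner ℝ x y : ℝ) = ∑ i, x i * y i := by
    simp [PiLp.inner_apply, mul_comm]
  rw [e1, EuclideanSpace.real_norm_sq_eq, EuclideanSpace.real_norm_sq_eq, sum_two_mul,
    sum_two_mul, sum_two_mul]
  refine le_trans (le_of_eq ?_) h
  unfold symp
  ring

lemma symp_add_left {n : ℕ} (x y z : EuclideanSpace ℝ (Fin (2 * n))) :
    symp (x + y) z = symp x z + symp y z := by
  simp only [symp, PiLp.add_apply, Finset.mul_sum, ← Finset.sum_add_distrib]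
  exact Finset.sum_congr rfl fun j _ => by ring

lemma symp_smul_left {n : ℕ} (r : ℝ) (x z : EuclideanSpace ℝ (Fin (2 * n))) :
    symp (r • x) z = r * symp x z := by
  simp only [symp, PiLp.smul_apply, smul_eq_mul, Finset.mul_sum]
  exact Finset.sum_congr rfl fun j _ => by ring

lemma symp_swap {n : ℕ} (x y : EuclideanSpace ℝ (Fin (2 * n))) :
    symp x y = - symp y x := by
  simp only [symp, Finset.mul_sum, ← Finset.sum_neg_distrib]
  exact Finset.sum_congr rfl fun j _ => by ring

lemma symp_self {n : ℕ} (x : EuclideanSpace ℝ (Fin (2 * n))) : symp x x = 0 := by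
  have := symp_swap x x
  linarith

lemma symp_neg_left {n : ℕ} (x z : EuclideanSpace ℝ (Fin (2 * n))) :
    symp (-x) z = - symp x z := by
  have := symp_smul_left (-1) x z
  simpa using this

lemma symp_add_right {n : ℕ} (x y z : EuclideanSpace ℝ (Fin (2 * n))) :
    symp x (y + z) = symp x y + symp x z := by
  rw [symp_swap, symp_add_left, symp_swap y, symp_swap z]; ring

lemma symp_smul_right {n : ℕ} (r : ℝ) (x z : EuclideanSpace ℝ (Fin (2 * n))) :
    symp x (r • z) = r * symp x z := by
  rw [symp_swap, symp_smul_left, symp_swap z]; ring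

lemma symp_neg_right {n : ℕ} (x z : EuclideanSpace ℝ (Fin (2 * n))) :
    symp x (-z) = - symp x z := by
  rw [symp_swap x (-z), symp_neg_left, symp_swap x z]

lemma continuous_symp {n : ℕ} : Continuous fun p : EuclideanSpace ℝ (Fin (2 * n)) ×
    EuclideanSpace ℝ (Fin (2 * n)) => symp p.1 p.2 := by
  unfold symp
  fun_prop

lemma continuous_hmul {n : ℕ} : Continuous fun p : Heis n × Heis n => hmul p.1 p.2 := by
  unfold hmul
  have h : Continuous fun p : Heis n × Heis n => symp p.1.1 p.2.1 :=
    continuous_symp.comp (by fun_prop : Continuous fun p : Heis n × Heis n => (p.1.1, p.2.1))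
  fun_prop

lemma continuous_KNorm {n : ℕ} : Continuous fun p : Heis n => KNorm p := by
  unfold KNorm
  apply Continuous.rpow_const (by fun_prop)
  intro x; right; norm_num

lemma continuous_dH {n : ℕ} : Continuous fun p : Heis n × Heis n => dH p.1 p.2 := by
  unfold dH
  apply continuous_KNorm.comp
  apply continuous_hmul.comp (f := fun p : Heis n × Heis n => (hinv p.1, p.2))
  unfold hinv
  fun_prop

lemma KNorm_nonneg {n : ℕ} (x : Heis n) : 0 ≤ KNorm x := by unfold KNorm; positivity

lemma KNorm_pow {n : ℕ} (x : Heis n) : KNorm x ^ 4 = ‖x.1‖ ^ 4 + x.2 ^ 2 := by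
  unfold KNorm
  rw [← Real.rpow_natCast, ← Real.rpow_mul (by positivity)]
  norm_num

lemma KNorm_sq {n : ℕ} (x : Heis n) : KNorm x ^ 2 = ‖(⟨‖x.1‖ ^ 2, x.2⟩ : ℂ)‖ := by
  have h1 : (KNorm x ^ 2) ^ 2 = ‖(⟨‖x.1‖ ^ 2, x.2⟩ : ℂ)‖ ^ 2 := by
    rw [Complex.sq_norm, Complex.normSq_mk, ← pow_mul, KNorm_pow]; ring
  exact (pow_left_inj₀ (by positivity) (by positivity) two_ne_zero).1 h1

lemma knorm_fst_le {n : ℕ} (x : Heis n) : ‖x.1‖ ≤ KNorm x := by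
  apply le_of_pow_le_pow_left₀ (n := 4) (by norm_num) (KNorm_nonneg x)
  rw [KNorm_pow]; nlinarith [sq_nonneg x.2]

lemma abs_snd_le {n : ℕ} (x : Heis n) : |x.2| ≤ KNorm x ^ 2 := by
  apply le_of_pow_le_pow_left₀ (n := 2) (by norm_num) (by positivity)
  rw [← pow_mul, KNorm_pow, sq_abs]
  have : 0 ≤ ‖x.1‖ ^ 4 := by positivity
  linarith

lemma KNorm_hmul_le {n : ℕ} (x y : Heis n) : KNorm (hmul x y) ≤ KNorm x + KNorm y := by
  have hx := KNorm_nonneg x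
  have hy := KNorm_nonneg y
  apply le_of_pow_le_pow_left₀ (n := 2) (by norm_num) (by positivity)
  rw [KNorm_sq]
  have e : (⟨‖(hmul x y).1‖ ^ 2, (hmul x y).2⟩ : ℂ) = ⟨‖x.1‖ ^ 2, x.2⟩ + ⟨‖y.1‖ ^ 2, y.2⟩ +
      ⟨2 * inner ℝ x.1 y.1, symp x.1 y.1⟩ := by
    apply Complex.ext
    · simp only [hmul, Complex.add_re, norm_add_sq_real]; ring
    · simp only [hmul, Complex.add_im]
  rw [e]
  have h3 : ‖(⟨2 * inner ℝ x.1 y.1, symp x.1 y.1⟩ : ℂ)‖ ≤ 2 * (‖x.1‖ * ‖y.1‖) := by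
    apply le_of_pow_le_pow_left₀ (n := 2) (by norm_num) (by positivity)
    rw [Complex.sq_norm, Complex.normSq_mk]
    nlinarith [symp_cs x.1 y.1]
  have h4 : ‖x.1‖ * ‖y.1‖ ≤ KNorm x * KNorm y :=
    mul_le_mul (knorm_fst_le x) (knorm_fst_le y) (norm_nonneg _) hx
  calc _ ≤ _ := norm_add₃_le
    _ ≤ KNorm x ^ 2 + KNorm y ^ 2 + 2 * (‖x.1‖ * ‖y.1‖) := by
      rw [KNorm_sq x, KNorm_sq y]; gcongr
    _ ≤ _ := by nlinarith

lemma KNorm_hinv {n : ℕ} (x : Heis n) : KNorm (hinv x) = KNorm x := by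
  simp [KNorm, hinv]

lemma dH_nonneg {n : ℕ} (x y : Heis n) : 0 ≤ dH x y := KNorm_nonneg _

lemma dH_self {n : ℕ} (x : Heis n) : dH x x = 0 := by
  simp [dH, hmul, hinv, KNorm, symp_neg_left, symp_self]

lemma dH_symm {n : ℕ} (x y : Heis n) : dH x y = dH y x := by
  unfold dH
  rw [← KNorm_hinv]
  congr 1
  refine Prod.ext ?_ ?_
  · simp only [hmul, hinv]; abel
  · simp only [hmul, hinv, symp_neg_left]
    rw [symp_swap y.1 x.1]; ring

lemma dH_triangle {n : ℕ} (x y z : Heis n) : dH x z ≤ dH x y + dH y z := by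
  unfold dH
  refine le_trans (le_of_eq ?_) (KNorm_hmul_le _ _)
  congr 1
  refine Prod.ext ?_ ?_
  · simp only [hmul, hinv]; abel
  · simp only [hmul, hinv, symp_neg_left, symp_add_left, symp_add_right, symp_neg_right, symp_self]
    ring

lemma mem_ballH_self {n : ℕ} (x : Heis n) {r : ℝ} (hr : 0 ≤ r) : x ∈ ballH x r := by
  simp [ballH, dH_self, hr]

lemma ballH_subset {n : ℕ} {x y : Heis n} {r R : ℝ} (h : dH x y + r ≤ R) :
    ballH y r ⊆ ballH x R := by
  intro z hz
  have := dH_triangle x y z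
  simp only [ballH, mem_ofPred_eq] at *
  linarith

lemma continuous_dH_right {n : ℕ} (x : Heis n) : Continuous fun y : Heis n => dH x y := by
  have h : Continuous fun y : Heis n => (x, y) := by fun_prop
  exact Continuous.comp (g := fun p : Heis n × Heis n => dH p.1 p.2) (f := fun y => (x, y))
    continuous_dH h

lemma isClosed_ballH {n : ℕ} (x : Heis n) (r : ℝ) : IsClosed (ballH x r) :=
  isClosed_le (continuous_dH_right x) continuous_const

lemma isOpen_obH {n : ℕ} (x : Heis n) (r : ℝ) : IsOpen {y | dH x y < r} :=
  isOpen_lt (continuous_dH_right x) continuous_const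

lemma dH_zero {n : ℕ} (x : Heis n) : dH 0 x = KNorm x := by
  have : symp (0 : EuclideanSpace ℝ (Fin (2 * n))) x.1 = 0 := by simp [symp]
  simp [dH, hmul, hinv, this]

lemma isCompact_ballH {n : ℕ} (x : Heis n) (r : ℝ) : IsCompact (ballH x r) := by
  have hsub : ballH x r ⊆ ballH 0 (dH 0 x + r) := ballH_subset le_rfl
  set R := dH 0 x + r
  have hc : IsCompact (Metric.closedBall (0 : EuclideanSpace ℝ (Fin (2 * n))) R ×ˢ
      Metric.closedBall (0 : ℝ) (R ^ 2)) :=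
    (isCompact_closedBall _ _).prod (isCompact_closedBall _ _)
  refine hc.of_isClosed_subset (isClosed_ballH x r) (hsub.trans ?_)
  intro z hz
  simp only [ballH, mem_ofPred_eq, dH_zero] at hz
  have h0 := KNorm_nonneg z
  refine ⟨?_, ?_⟩
  · simpa using (knorm_fst_le z).trans hz
  · have := abs_snd_le z
    simp only [Metric.mem_closedBall, dist_zero_right, Real.norm_eq_abs]
    nlinarith

lemma exists_ballH_subset {n : ℕ} {x : Heis n} {U : Set (Heis n)} (hU : IsOpen U) (hx : x ∈ U) :
    ∃ ε > 0, ∀ r, r < ε → ballH x r ⊆ U := by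
  have hcont : Continuous fun w : Heis n => hmul x w :=
    continuous_hmul.comp (by fun_prop : Continuous fun w : Heis n => (x, w))
  have h0 : hmul x 0 = x := by
    have : symp x.1 (0 : EuclideanSpace ℝ (Fin (2 * n))) = 0 := by simp [symp]
    simp [hmul, this]
  have hV : (fun w : Heis n => hmul x w) ⁻¹' U ∈ nhds (0 : Heis n) :=
    (hU.preimage hcont).mem_nhds (by simpa [h0] using hx)
  obtain ⟨ε, hε, hb⟩ := Metric.mem_nhds_iff.1 hV
  refine ⟨min ε 1, by positivity, fun r hr z hz => ?_⟩
  have hw : hmul x (hmul (hinv x) z) = z := by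
    refine Prod.ext ?_ ?_
    · simp [hmul, hinv]
    · simp only [hmul, hinv, symp_neg_left, symp_add_right, symp_neg_right, symp_self]
      ring
  have hz' : KNorm (hmul (hinv x) z) ≤ r := hz
  set w := hmul (hinv x) z
  rw [← hw]
  apply hb
  have h1 := knorm_fst_le w
  have h2 := abs_snd_le w
  have h3 := KNorm_nonneg w
  have h4 := min_le_left ε 1
  have h5 := min_le_right ε 1
  rw [mem_ball_zero_iff, Prod.norm_def, max_lt_iff, Real.norm_eq_abs]
  constructor
  · linarith
  · nlinarith

/-- The blow-down map `y ↦ x · δ_r y`. -/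
def Smap {n : ℕ} (x : Heis n) (r : ℝ) (y : Heis n) : Heis n := hmul x (dil r y)

/-- The blow-up map `w ↦ δ_{1/r}(x⁻¹ · w)`. -/
def Tmap {n : ℕ} (x : Heis n) (r : ℝ) (w : Heis n) : Heis n := dil r⁻¹ (hmul (hinv x) w)

lemma Smap_Tmap {n : ℕ} (x : Heis n) {r : ℝ} (hr : 0 < r) (w : Heis n) :
    Smap x r (Tmap x r w) = w := by
  unfold Smap Tmap
  have : dil r (dil r⁻¹ (hmul (hinv x) w)) = hmul (hinv x) w := by
    refine Prod.ext ?_ ?_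
    · simp only [dil, smul_smul, mul_inv_cancel₀ hr.ne', one_smul]
    · simp only [dil]; field_simp
  rw [this]
  refine Prod.ext ?_ ?_
  · simp [hmul, hinv]
  · simp only [hmul, hinv, symp_neg_left, symp_add_right, symp_neg_right, symp_self]
    ring

lemma dH_Smap {n : ℕ} (x : Heis n) {r : ℝ} (hr : 0 < r) (y z : Heis n) :
    dH (Smap x r y) (Smap x r z) = r * dH y z := by
  have e : hmul (hinv (Smap x r y)) (Smap x r z) = dil r (hmul (hinv y) z) := by
    refine Prod.ext ?_ ?_
    · simp only [Smap, hmul, hinv, dil, smul_add, smul_neg]; abel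
    · simp only [Smap, hmul, hinv, dil, symp_neg_left, symp_add_right, symp_self,
        symp_add_left, symp_smul_left, symp_smul_right]
      rw [symp_swap y.1 x.1]; ring
  unfold dH
  rw [e]
  apply (pow_left_inj₀ (KNorm_nonneg _) (mul_nonneg hr.le (KNorm_nonneg _)) four_ne_zero).1
  rw [mul_pow, KNorm_pow, KNorm_pow]
  simp only [dil, norm_smul, Real.norm_eq_abs, abs_of_pos hr]
  ring

lemma Tmap_preimage {n : ℕ} (x : Heis n) {r : ℝ} (hr : 0 < r) (y : Heis n) (R : ℝ) :
    Tmap x r ⁻¹' ballH y R = ballH (Smap x r y) (r * R) := by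
  ext w
  have := dH_Smap x hr y (Tmap x r w)
  rw [Smap_Tmap x hr] at this
  simp only [ballH, mem_preimage, mem_ofPred_eq, this]
  exact (mul_le_mul_iff_right₀ hr).symm

lemma Smap_zero {n : ℕ} (x : Heis n) (r : ℝ) : Smap x r 0 = x := by
  have : symp x.1 (0 : EuclideanSpace ℝ (Fin (2 * n))) = 0 := by simp [symp]
  simp [Smap, hmul, dil, this]

lemma continuous_Tmap {n : ℕ} (x : Heis n) (r : ℝ) : Continuous (Tmap x r) := by
  have hcont : Continuous fun w : Heis n => hmul (hinv x) w :=
    continuous_hmul.comp (by fun_prop : Continuous fun w : Heis n => (hinv x, w))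
  have h2 : Continuous fun w : Heis n => dil r⁻¹ w := by unfold dil; fun_prop
  exact h2.comp hcont

/-! ### Weak limits along ultrafilters -/

open scoped CompactlySupported in
lemma exists_cc {X : Type*} [TopologicalSpace X] [T2Space X] [LocallyCompactSpace X]
    {K V : Set X} (hK : IsCompact K) (hV : IsOpen V) (hKV : K ⊆ V) :
    ∃ f : C_c(X, ℝ≥0), (∀ x ∈ K, f x = 1) ∧ (∀ x, x ∉ V → f x = 0) ∧ ∀ x, f x ≤ 1 := by
  obtain ⟨f, hf1, hf2, hf3, hf4⟩ := exists_continuousMap_one_of_isCompact_subset_isOpen hK hV hKV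
  refine ⟨⟨⟨fun x => (f x).toNNReal, by fun_prop⟩, ?_⟩, ?_, ?_, ?_⟩
  · exact HasCompactSupport.comp_left (g := Real.toNNReal) hf2 (by simp)
  · intro x hx
    have := hf1 hx
    simp_all
  · intro x hx
    have : f x = 0 := image_eq_zero_of_notMem_tsupport fun h => hx (hf3 h)
    simp [this]
  · intro x
    have := (hf4 x).2
    simpa using this

open scoped CompactlySupported in
lemma exists_weak_limit {X ι : Type*} [TopologicalSpace X] [T2Space X] [LocallyCompactSpace X]
    [MeasurableSpace X] [BorelSpace X] (U : Ultrafilter ι) (m : ι → Measure X)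
    (hm : ∀ K : Set X, IsCompact K → ∃ C : ℝ≥0∞, C ≠ ⊤ ∧ ∀ᶠ i in (U : Filter ι), m i K ≤ C) :
    ∃ ν : Measure X, ν.Regular ∧
      (∀ K V : Set X, IsCompact K → IsOpen V → K ⊆ V → ∀ C : ℝ≥0∞,
        (∀ᶠ i in (U : Filter ι), m i V ≤ C) → ν K ≤ C) ∧
      (∀ K V : Set X, IsCompact K → IsOpen V → K ⊆ V → ∀ C : ℝ≥0∞,
        (∀ᶠ i in (U : Filter ι), C ≤ m i K) → C ≤ ν V) := by
  set L : C_c(X, ℝ≥0) → ℝ≥0∞ := fun f => (U.map fun i => ∫⁻ x, (f x : ℝ≥0∞) ∂(m i)).lim with hL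
  have hlim : ∀ f : C_c(X, ℝ≥0), Tendsto (fun i => ∫⁻ x, (f x : ℝ≥0∞) ∂(m i)) U (nhds (L f)) :=
    fun f => (U.map fun i => ∫⁻ x, (f x : ℝ≥0∞) ∂(m i)).le_nhds_lim
  have hmeas : ∀ f : C_c(X, ℝ≥0), Measurable fun x => (f x : ℝ≥0∞) := fun f =>
    (ENNReal.continuous_coe.comp f.continuous).measurable
  have hfin : ∀ f : C_c(X, ℝ≥0), L f ≠ ⊤ := by
    intro f
    have hK : IsCompact (tsupport f) := f.hasCompactSupport
    obtain ⟨C, hC, hCe⟩ := hm _ hK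
    obtain ⟨M, hM⟩ := (f.hasCompactSupport.isCompact_range f.continuous).bddAbove
    have : L f ≤ M * C := by
      refine le_of_tendsto (hlim f) (hCe.mono fun i hi => ?_)
      calc ∫⁻ x, (f x : ℝ≥0∞) ∂(m i) ≤ ∫⁻ x, (tsupport f).indicator (fun _ => (M : ℝ≥0∞)) x ∂(m i) := by
            apply lintegral_mono
            intro x
            by_cases hx : x ∈ tsupport f
            · simp only [indicator_of_mem hx]
              exact_mod_cast hM ⟨x, rfl⟩
            · simp [image_eq_zero_of_notMem_tsupport hx]
        _ ≤ M * m i (tsupport f) := lintegral_indicator_const_le _ _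
        _ ≤ M * C := by gcongr
    exact ne_top_of_le_ne_top (ENNReal.mul_ne_top ENNReal.coe_ne_top hC) this
  let Λ : C_c(X, ℝ≥0) →ₗ[ℝ≥0] ℝ≥0 :=
    { toFun := fun f => (L f).toNNReal
      map_add' := by
        intro f g
        rw [← ENNReal.toNNReal_add (hfin f) (hfin g)]
        congr 1
        refine tendsto_nhds_unique (hlim (f + g)) (((hlim f).add (hlim g)).congr fun i => ?_)
        rw [← lintegral_add_left (hmeas f)]
        simp
      map_smul' := by
        intro c f
        simp only [RingHom.id_apply, smul_eq_mul]
        rw [← ENNReal.toNNReal_coe c, ← ENNReal.toNNReal_mul]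
        congr 1
        refine tendsto_nhds_unique (hlim _) ((ENNReal.Tendsto.const_mul (hlim f)
          (Or.inr ENNReal.coe_ne_top)).congr fun i => ?_)
        rw [← lintegral_const_mul _ (hmeas f)]
        simp }
  have hΛ : ∀ f, ∫⁻ x, (f x : ℝ≥0∞) ∂(NNRealRMK.rieszMeasure Λ) = L f := by
    intro f
    rw [NNRealRMK.lintegral_rieszMeasure]
    exact ENNReal.coe_toNNReal (hfin f)
  have up : ∀ (K V : Set X) (f : C_c(X, ℝ≥0)) (ρ : Measure X), IsCompact K →
      (∀ x ∈ K, f x = 1) → ρ K ≤ ∫⁻ x, (f x : ℝ≥0∞) ∂ρ := by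
    intro K V f ρ hK h1
    rw [← lintegral_indicator_one hK.measurableSet]
    apply lintegral_mono
    intro x
    by_cases hx : x ∈ K
    · simp [hx, h1]
    · simp [hx]
  have dn : ∀ (V : Set X) (f : C_c(X, ℝ≥0)) (ρ : Measure X), IsOpen V →
      (∀ x, x ∉ V → f x = 0) → (∀ x, f x ≤ 1) → ∫⁻ x, (f x : ℝ≥0∞) ∂ρ ≤ ρ V := by
    intro V f ρ hV h0 h1
    rw [← lintegral_indicator_one hV.measurableSet]
    apply lintegral_mono
    intro x
    by_cases hx : x ∈ V
    · simpa [hx] using h1 x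
    · simp [hx, h0]
  refine ⟨NNRealRMK.rieszMeasure Λ, inferInstance, ?_, ?_⟩
  · intro K V hK hV hKV C hC
    obtain ⟨f, hf1, hf0, hfl⟩ := exists_cc hK hV hKV
    refine (up K V f _ hK hf1).trans ?_
    rw [hΛ]
    exact le_of_tendsto (hlim f) (hC.mono fun i hi => (dn V f _ hV hf0 hfl).trans hi)
  · intro K V hK hV hKV C hC
    obtain ⟨f, hf1, hf0, hfl⟩ := exists_cc hK hV hKV
    refine le_trans ?_ (dn V f _ hV hf0 hfl)
    rw [hΛ]
    exact ge_of_tendsto (hlim f) (hC.mono fun i hi => hi.trans (up K V f _ hK hf1))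

/-! ### A density theorem -/

lemma ofReal_rpow_mul {s a r : ℝ} (ha : 0 ≤ a) (hr : 0 ≤ r) :
    ENNReal.ofReal ((a * r) ^ s) = ENNReal.ofReal (a ^ s) * ENNReal.ofReal (r ^ s) := by
  rw [Real.mul_rpow ha hr, ENNReal.ofReal_mul (by positivity)]

lemma density_null {n : ℕ} {s : ℝ} {μ ν : Measure (Heis n)} [ν.OuterRegular]
    {E : Set (Heis n)} (hE : ν E = 0) {M : ℝ≥0} {ρ : ℝ} (hρ : 0 < ρ)
    (hM : ∀ x ∈ E, ∀ r, 0 < r → r < ρ → μ (ballH x r) ≤ M * ENNReal.ofReal (r ^ s))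
    {t : ℝ≥0} (ht : 0 < t) :
    μ {x ∈ E | ¬ ∀ᶠ r in nhdsWithin (0 : ℝ) (Ioi 0),
      ν (ballH x r) ≤ t * ENNReal.ofReal (r ^ s)} = 0 := by
  set A := {x ∈ E | ¬ ∀ᶠ r in nhdsWithin (0 : ℝ) (Ioi 0),
      ν (ballH x r) ≤ t * ENNReal.ofReal (r ^ s)} with hA
  set D : ℝ≥0∞ := M * ENNReal.ofReal ((3 : ℝ) ^ s) * (t : ℝ≥0∞)⁻¹ with hD
  have ht0 : (t : ℝ≥0∞) ≠ 0 := by exact_mod_cast ht.ne'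
  have hDtop : D ≠ ⊤ := ENNReal.mul_ne_top (ENNReal.mul_ne_top ENNReal.coe_ne_top
    ENNReal.ofReal_ne_top) (ENNReal.inv_ne_top.2 ht0)
  have main : ∀ ε : ℝ≥0, 0 < ε → μ A ≤ D * ε := by
    intro ε hε
    obtain ⟨U, hEU, hUo, hU⟩ := Set.exists_isOpen_lt_of_lt (μ := ν) E (ε : ℝ≥0∞)
      (by rw [hE]; exact_mod_cast hε)
    set T : Set (Heis n × ℝ) := {p | p.1 ∈ A ∧ 0 < p.2 ∧ 3 * p.2 < ρ ∧ ballH p.1 p.2 ⊆ U ∧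
      t * ENNReal.ofReal (p.2 ^ s) < ν (ballH p.1 p.2)} with hT
    have hTex : ∀ x ∈ A, ∃ r, (x, r) ∈ T := by
      intro x hx
      obtain ⟨ε', hε', hb⟩ := exists_ballH_subset hUo (hEU hx.1)
      have h1 : ∃ᶠ r in nhdsWithin (0 : ℝ) (Ioi 0), t * ENNReal.ofReal (r ^ s) < ν (ballH x r) := by
        have := hx.2
        rw [Filter.not_eventually] at this
        exact this.mono fun r hr => not_le.1 hr
      have h2 : ∀ᶠ r in nhdsWithin (0 : ℝ) (Ioi 0), r ∈ Ioo 0 (min ε' (ρ / 3)) :=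
        Ioo_mem_nhdsGT (by positivity)
      obtain ⟨r, hr, hr2⟩ := (h1.and_eventually h2).exists
      have := lt_min_iff.1 hr2.2
      exact ⟨r, hx, hr2.1, by linarith [this.2], hb r this.1, hr⟩
    obtain ⟨u, huT, hdisj, hcov⟩ := Vitali.exists_disjoint_subfamily_covering_enlargement
      (fun p : Heis n × ℝ => ballH p.1 p.2) T (fun p => p.2) 2 (by norm_num)
      (fun p hp => hp.2.1.le) (ρ / 3) (fun p hp => by have := hp.2.2.1; linarith)
      (fun p hp => ⟨p.1, mem_ballH_self _ hp.2.1.le⟩)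
    have hucount : u.Countable := by
      refine hdisj.countable_of_nonempty_interior fun p hp => ⟨p.1, ?_⟩
      refine mem_interior.2 ⟨{y | dH p.1 y < p.2}, fun y hy =>
        (le_of_lt (show dH p.1 y < p.2 from hy) : dH p.1 y ≤ p.2), isOpen_obH _ _, ?_⟩
      have := (huT hp).2.1
      simpa [dH_self] using this
    have hcover : A ⊆ ⋃ p ∈ u, ballH p.1 (3 * p.2) := by
      intro x hx
      obtain ⟨r, hr⟩ := hTex x hx
      obtain ⟨b, hb, ⟨z, hz1, hz2⟩, hle⟩ := hcov _ hr
      simp only [mem_iUnion]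
      refine ⟨b, hb, ?_⟩
      have h1 : dH x z ≤ r := hz1
      have h2 : dH b.1 z ≤ b.2 := hz2
      have h3 := dH_triangle b.1 z x
      rw [dH_symm z x] at h3
      change dH b.1 x ≤ 3 * b.2
      simp only at hle
      linarith
    have hterm : ∀ p ∈ u, μ (ballH p.1 (3 * p.2)) ≤ D * ν (ballH p.1 p.2) := by
      intro p hp
      obtain ⟨hpA, h0, h3, -, hν⟩ := huT hp
      calc μ (ballH p.1 (3 * p.2)) ≤ M * ENNReal.ofReal ((3 * p.2) ^ s) :=
            hM _ hpA.1 _ (by linarith) h3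
        _ = M * ENNReal.ofReal ((3 : ℝ) ^ s) * ((t : ℝ≥0∞)⁻¹ * (t * ENNReal.ofReal (p.2 ^ s))) := by
            rw [ofReal_rpow_mul (by norm_num) h0.le, ← mul_assoc (t : ℝ≥0∞)⁻¹,
              ENNReal.inv_mul_cancel ht0 ENNReal.coe_ne_top, one_mul, mul_assoc]
        _ ≤ M * ENNReal.ofReal ((3 : ℝ) ^ s) * ((t : ℝ≥0∞)⁻¹ * ν (ballH p.1 p.2)) := by
            gcongr
        _ = _ := by rw [hD]; ring
    calc μ A ≤ μ (⋃ p ∈ u, ballH p.1 (3 * p.2)) := measure_mono hcover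
      _ ≤ ∑' p : u, μ (ballH p.1.1 (3 * p.1.2)) := measure_biUnion_le _ hucount _
      _ ≤ ∑' p : u, D * ν (ballH p.1.1 p.1.2) := ENNReal.tsum_le_tsum fun p => hterm p.1 p.2
      _ = D * ∑' p : u, ν (ballH p.1.1 p.1.2) := ENNReal.tsum_mul_left
      _ = D * ν (⋃ p ∈ u, ballH p.1 p.2) := by
          rw [measure_biUnion hucount hdisj fun p _ => (isClosed_ballH _ _).measurableSet]
      _ ≤ D * ν U := by
          gcongr
          exact iUnion₂_subset fun p hp => (huT hp).2.2.2.1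
      _ ≤ D * ε := by gcongr
  by_contra hne
  have hpos : 0 < μ A := pos_iff_ne_zero.2 hne
  have htend : Tendsto (fun ε : ℝ≥0 => D * (ε : ℝ≥0∞)) (nhdsWithin 0 (Ioi 0)) (nhds 0) := by
    have : Tendsto (fun ε : ℝ≥0 => D * (ε : ℝ≥0∞)) (nhds 0) (nhds (D * ((0 : ℝ≥0) : ℝ≥0∞))) :=
      ENNReal.Tendsto.const_mul (ENNReal.tendsto_coe.2 tendsto_id) (Or.inr hDtop)
    simp only [ENNReal.coe_zero, mul_zero] at this
    exact this.mono_left nhdsWithin_le_nhds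
  have := ge_of_tendsto htend (eventually_mem_nhdsWithin.mono fun ε hε => main ε hε)
  exact hpos.not_ge this

/-! ### Blow-up -/

lemma blowup {n : ℕ} {s : ℝ} (μ : Measure (Heis n)) [SFinite μ] (x : Heis n)
    (d : ℝ≥0∞) (hd0 : 0 < d) (hdt : d < ⊤) (hd : HasDensity μ s x d)
    (hG : ∀ a b : ℝ≥0∞, a < d → d < b → ∃ E : Set (Heis n), ∃ ρ : ℝ, 0 < ρ ∧
      (∀ z ∈ E, ∀ r, 0 < r → r < ρ → a * ENNReal.ofReal (r ^ s) ≤ μ (ballH z r) ∧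
        μ (ballH z r) ≤ b * ENNReal.ofReal (r ^ s)) ∧
      ∀ t : ℝ≥0, 0 < t → ∀ᶠ r in nhdsWithin (0 : ℝ) (Ioi 0),
        μ (ballH x r \ toMeasurable μ E) ≤ t * ENNReal.ofReal (r ^ s)) :
    ∃ ν : Measure (Heis n), ν ≠ 0 ∧ ν.Regular ∧ ∃ c : ℝ, 0 < c ∧
      ∀ x ∈ suppH ν, ∀ r : ℝ, 0 < r → ν (ballH x r) = ENNReal.ofReal (c * r ^ s) := by
  set m : ℝ → Measure (Heis n) := fun r => (ENNReal.ofReal (r ^ s))⁻¹ • μ.map (Tmap x r) with hmdef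
  have hmr : ∀ r, 0 < r → ∀ y R,
      m r (ballH y R) = μ (ballH (Smap x r y) (r * R)) / ENNReal.ofReal (r ^ s) := by
    intro r hr y R
    simp only [hmdef, Measure.smul_apply, smul_eq_mul]
    rw [Measure.map_apply (continuous_Tmap x r).measurable (isClosed_ballH _ _).measurableSet,
      Tmap_preimage x hr, ENNReal.div_eq_inv_mul]
  have hrs : ∀ r : ℝ, 0 < r → ENNReal.ofReal (r ^ s) ≠ 0 := fun r hr => by
    have := Real.rpow_pos_of_pos hr s
    simpa using this
  set F := nhdsWithin (0 : ℝ) (Ioi 0) with hF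
  have hpos : ∀ᶠ r in F, 0 < r := eventually_mem_nhdsWithin
  have hscale : ∀ R : ℝ, 0 < R → Tendsto (fun r => r * R) F F := by
    intro R hR
    refine tendsto_nhdsWithin_iff.2 ⟨?_, hpos.mono fun r hr => mul_pos hr hR⟩
    have : Tendsto (fun r : ℝ => r * R) (nhds 0) (nhds (0 * R)) := tendsto_id.mul_const R
    rw [zero_mul] at this
    exact this.mono_left nhdsWithin_le_nhds
  have hlt : ∀ R ρ : ℝ, 0 < R → 0 < ρ → ∀ᶠ r in F, r * R < ρ := by
    intro R ρ hR hρ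
    exact (hscale R hR).eventually (nhdsWithin_le_nhds (Iio_mem_nhds hρ))
  have hm0 : ∀ R : ℝ, 0 < R → Tendsto (fun r => m r (ballH 0 R)) F
      (nhds (d * ENNReal.ofReal (R ^ s))) := by
    intro R hR
    have h1 := ENNReal.Tendsto.mul_const (b := ENNReal.ofReal (R ^ s)) (hd.comp (hscale R hR))
      (Or.inr ENNReal.ofReal_ne_top)
    refine h1.congr' (hpos.mono fun r hr => ?_)
    simp only [Function.comp]
    rw [hmr r hr, Smap_zero, ofReal_rpow_mul hr.le hR.le, ENNReal.div_eq_inv_mul,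
      ENNReal.div_eq_inv_mul, ENNReal.mul_inv (Or.inl (hrs r hr)) (Or.inl ENNReal.ofReal_ne_top)]
    calc _ = (ENNReal.ofReal (r ^ s))⁻¹ * μ (ballH x (r * R)) *
          ((ENNReal.ofReal (R ^ s))⁻¹ * ENNReal.ofReal (R ^ s)) := by ring
      _ = _ := by rw [ENNReal.inv_mul_cancel (hrs R hR) ENNReal.ofReal_ne_top, mul_one]
  set U : Ultrafilter ℝ := Ultrafilter.of F with hU
  have hUF : (U : Filter ℝ) ≤ F := Ultrafilter.of_le F
  obtain ⟨ν, hνreg, hup, hlow⟩ := exists_weak_limit U m (by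
    intro K hK
    obtain ⟨R, hR⟩ := (hK.image (continuous_KNorm (n := n))).bddAbove
    have hsub : K ⊆ ballH 0 (max R 1) := by
      intro y hy
      change dH 0 y ≤ _
      rw [dH_zero]
      exact (hR ⟨y, hy, rfl⟩).trans (le_max_left _ _)
    have hR1 : 0 < max R 1 := by positivity
    have hfin : d * ENNReal.ofReal ((max R 1) ^ s) ≠ ⊤ :=
      ENNReal.mul_ne_top hdt.ne ENNReal.ofReal_ne_top
    refine ⟨d * ENNReal.ofReal ((max R 1) ^ s) + 1, by simp [hfin], ?_⟩
    refine hUF ?_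
    have := (hm0 _ hR1).eventually (Iio_mem_nhds (ENNReal.lt_add_right hfin one_ne_zero))
    exact this.mono fun r hr => (measure_mono hsub).trans (le_of_lt hr))
  have hball_ob : ∀ (y : Heis n) {R R' : ℝ}, R < R' → ballH y R ⊆ {z | dH y z < R'} :=
    fun y R R' h z hz => lt_of_le_of_lt (show dH y z ≤ R from hz) h
  have hob_ball : ∀ (y : Heis n) (R : ℝ), {z | dH y z < R} ⊆ ballH y R :=
    fun y R z hz => le_of_lt (show dH y z < R from hz)
  -- points of the support are approximated by good points
  have approx : ∀ y ∈ suppH ν, ∀ E : Set (Heis n),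
      (∀ t : ℝ≥0, 0 < t → ∀ᶠ r in F,
        μ (ballH x r \ toMeasurable μ E) ≤ t * ENNReal.ofReal (r ^ s)) →
      ∀ η : ℝ, 0 < η → ∀ᶠ r in (U : Filter ℝ), ∃ z ∈ E, dH (Smap x r y) z ≤ r * η := by
    intro y hy E hE η hη
    obtain ⟨c, hc0, hc⟩ := ENNReal.lt_iff_exists_nnreal_btwn.1 (hy (η / 2) (by positivity))
    have hc0' : 0 < c := by exact_mod_cast hc0
    have h1 : ∀ᶠ r in (U : Filter ℝ), (c : ℝ≥0∞) ≤ m r (ballH y η) := by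
      by_contra hcon
      rw [← Ultrafilter.eventually_not] at hcon
      refine hc.not_ge (hup _ {z | dH y z < η} (isCompact_ballH y (η / 2)) (isOpen_obH y η)
        (hball_ob y (by linarith)) c (hcon.mono fun r hr => ?_))
      exact (measure_mono (hob_ball y η)).trans (not_le.1 hr).le
    set R : ℝ := dH 0 y + η with hR
    have hR0 : 0 < R := by have := dH_nonneg 0 y; linarith
    set T : ℝ≥0 := Real.toNNReal (R ^ s) with hT
    have htpos : 0 < c / (T + 1) := by positivity
    have htT : c / (T + 1) * T < c := by
      rw [div_mul_eq_mul_div, div_lt_iff₀ (by positivity)]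
      exact mul_lt_mul_of_pos_left (lt_add_one T) hc0'
    have h2 := (hscale R hR0).eventually (hE _ htpos)
    filter_upwards [h1, hUF h2, hUF hpos] with r h1 h2 hr
    by_contra hcon
    push Not at hcon
    have hempty : E ∩ ballH (Smap x r y) (r * η) = ∅ := by
      ext z
      simp only [mem_inter_iff, mem_empty_iff_false, iff_false, not_and]
      intro hz hz2
      exact (hcon z hz).not_ge hz2
    have hsub : ballH (Smap x r y) (r * η) ⊆ ballH x (r * R) := by
      apply ballH_subset
      have : dH x (Smap x r y) = r * dH 0 y := by
        have := dH_Smap x hr 0 y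
        rwa [Smap_zero] at this
      rw [this, hR]; linarith
    have h3 : μ (ballH (Smap x r y) (r * η)) ≤
        (c / (T + 1) : ℝ≥0) * ENNReal.ofReal ((r * R) ^ s) := by
      calc _ ≤ μ (toMeasurable μ E ∩ ballH (Smap x r y) (r * η)) +
            μ (ballH (Smap x r y) (r * η) \ toMeasurable μ E) := by
            rw [inter_comm]; exact measure_le_inter_add_sdiff _ _ _
        _ = μ (ballH (Smap x r y) (r * η) \ toMeasurable μ E) := by
            rw [Measure.measure_toMeasurable_inter_of_sFinite (isClosed_ballH _ _).measurableSet,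
              hempty, measure_empty, zero_add]
        _ ≤ μ (ballH x (r * R) \ toMeasurable μ E) := measure_mono (sdiff_subset_sdiff_left hsub)
        _ ≤ _ := h2
    rw [hmr r hr, ENNReal.le_div_iff_mul_le (Or.inl (hrs r hr)) (Or.inl ENNReal.ofReal_ne_top)] at h1
    have h4 := h1.trans h3
    rw [ofReal_rpow_mul hr.le hR0.le, mul_comm (ENNReal.ofReal (r ^ s)), ← mul_assoc,
      ENNReal.mul_le_mul_iff_left (hrs r hr) ENNReal.ofReal_ne_top] at h4
    have h5 : c ≤ c / (T + 1) * T := by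
      rw [ENNReal.ofReal, ← hT] at h4
      exact_mod_cast h4
    exact h5.not_gt htT
  have upper : ∀ y ∈ suppH ν, ∀ R : ℝ, 0 < R → ∀ b, d < b → ∀ η : ℝ, 0 < η →
      ν (ballH y R) ≤ b * ENNReal.ofReal ((R + 2 * η) ^ s) := by
    intro y hy R hR b hb η hη
    obtain ⟨E, ρ, hρ, hE, hEd⟩ := hG 0 b hd0 hb
    refine hup _ {z | dH y z < R + η} (isCompact_ballH y R) (isOpen_obH y _)
      (hball_ob y (by linarith)) _ ?_
    filter_upwards [approx y hy E hEd η hη, hUF hpos,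
      hUF (hlt (R + 2 * η) ρ (by positivity) hρ)] with r ⟨z, hzE, hz⟩ hr hrρ
    refine (measure_mono (hob_ball y _)).trans ?_
    rw [hmr r hr]
    apply ENNReal.div_le_of_le_mul
    rw [mul_assoc, ← ofReal_rpow_mul (by positivity) hr.le, mul_comm _ r]
    refine (measure_mono (ballH_subset ?_)).trans (hE z hzE _ (by positivity) hrρ).2
    rw [dH_symm]; linarith
  have lower : ∀ y ∈ suppH ν, ∀ R : ℝ, ∀ a, a < d → ∀ η : ℝ, 0 < η → 0 < R - 2 * η →
      a * ENNReal.ofReal ((R - 2 * η) ^ s) ≤ ν (ballH y R) := by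
    intro y hy R a ha η hη hR
    obtain ⟨E, ρ, hρ, hE, hEd⟩ := hG a ⊤ ha hdt
    refine le_trans (hlow (ballH y (R - η)) {z | dH y z < R} (isCompact_ballH y _) (isOpen_obH y _)
      (hball_ob y (by linarith)) _ ?_) (measure_mono (hob_ball y R))
    filter_upwards [approx y hy E hEd η hη, hUF hpos,
      hUF (hlt (R - 2 * η) ρ hR hρ)] with r ⟨z, hzE, hz⟩ hr hrρ
    rw [hmr r hr, ENNReal.le_div_iff_mul_le (Or.inl (hrs r hr)) (Or.inl ENNReal.ofReal_ne_top)]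
    rw [mul_assoc, ← ofReal_rpow_mul hR.le hr.le, mul_comm _ r]
    refine (hE z hzE _ (by positivity) hrρ).1.trans (measure_mono (ballH_subset ?_))
    linarith
  have hcontη : ∀ R k : ℝ, 0 < R → ∀ b : ℝ≥0∞,
      Tendsto (fun η : ℝ => b * ENNReal.ofReal ((R + k * η) ^ s)) F
        (nhds (b * ENNReal.ofReal (R ^ s))) := by
    intro R k hR b
    refine ENNReal.Tendsto.const_mul (ENNReal.tendsto_ofReal ?_) (Or.inl (hrs R hR))
    have h1 : ContinuousAt (fun η : ℝ => (R + k * η) ^ s) 0 := by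
      apply ContinuousAt.rpow_const (by fun_prop)
      left; simp [hR.ne']
    have h2 : Tendsto (fun η : ℝ => (R + k * η) ^ s) (nhds 0) (nhds (R ^ s)) := by
      have := h1.tendsto
      simpa using this
    exact h2.mono_left nhdsWithin_le_nhds
  have hcontb : ∀ R : ℝ, Tendsto (fun b : ℝ≥0∞ => b * ENNReal.ofReal (R ^ s)) (nhds d)
        (nhds (d * ENNReal.ofReal (R ^ s))) := fun R =>
    ENNReal.Tendsto.mul_const tendsto_id (Or.inr ENNReal.ofReal_ne_top)
  have hball : ∀ y ∈ suppH ν, ∀ R : ℝ, 0 < R → ν (ballH y R) = d * ENNReal.ofReal (R ^ s) := by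
    intro y hy R hR
    apply le_antisymm
    · have : (nhdsWithin d (Ioi d)).NeBot := nhdsGT_neBot_of_exists_gt ⟨⊤, hdt⟩
      refine ge_of_tendsto ((hcontb R).mono_left (nhdsWithin_le_nhds (s := Ioi d)))
        (eventually_mem_nhdsWithin.mono fun b hb => ?_)
      exact ge_of_tendsto (hcontη R 2 hR b) (hpos.mono fun η hη => upper y hy R hR b hb η hη)
    · have : (nhdsWithin d (Iio d)).NeBot := nhdsLT_neBot_of_exists_lt ⟨0, hd0⟩
      refine le_of_tendsto ((hcontb R).mono_left (nhdsWithin_le_nhds (s := Iio d)))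
        (eventually_mem_nhdsWithin.mono fun a ha => ?_)
      refine le_of_tendsto (hcontη R (-2) hR a) ?_
      filter_upwards [hpos, hlt 2 R two_pos hR] with η hη hηR
      have := lower y hy R a ha η hη (by linarith)
      rwa [sub_eq_add_neg, ← neg_mul] at this
  refine ⟨ν, ?_, hνreg, d.toReal, ENNReal.toReal_pos hd0.ne' hdt.ne, ?_⟩
  · rintro rfl
    have h1 := hm0 1 one_pos
    rw [Real.one_rpow, ENNReal.ofReal_one, mul_one] at h1
    obtain ⟨c, hc0, hc⟩ := ENNReal.lt_iff_exists_nnreal_btwn.1 hd0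
    have h2 := hlow (ballH 0 1) {z | dH 0 z < 2} (isCompact_ballH _ _) (isOpen_obH _ _)
      (hball_ob 0 (by norm_num)) c (hUF ((h1.eventually (Ioi_mem_nhds hc)).mono fun r hr => le_of_lt hr))
    simp only [Measure.coe_zero, Pi.zero_apply] at h2
    exact hc0.not_ge h2
  · intro y hy R hR
    rw [hball y hy R hR, ENNReal.ofReal_mul ENNReal.toReal_nonneg, ENNReal.ofReal_toReal hdt.ne]

/-- If there is a Radon measure `μ` on `(ℍⁿ, d_H)` whose `s`-density exists and is positive
and finite on a set of positive `μ`-measure, then there exists a nonzero `s`-uniform Radon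
measure `ν` on `(ℍⁿ, d_H)`. -/
theorem statement10 (n : ℕ) (s : ℝ) (hs : 0 < s)
    (μ : Measure (Heis n)) [μ.Regular]
    (h : 0 < μ {x : Heis n | ∃ d : ℝ≥0∞, 0 < d ∧ d < ⊤ ∧ HasDensity μ s x d}) :
    ∃ ν : Measure (Heis n), ν ≠ 0 ∧ ν.Regular ∧ ∃ c : ℝ, 0 < c ∧
      ∀ x ∈ suppH ν, ∀ r : ℝ, 0 < r → ν (ballH x r) = ENNReal.ofReal (c * r ^ s) := by 
  set G : ℚ → ℚ → ℕ → Set (Heis n) := fun a b l => {x | ∀ r : ℝ, 0 < r → r < 1 / ((l : ℝ) + 1) →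
    ((a : ℝ).toNNReal : ℝ≥0∞) * ENNReal.ofReal (r ^ s) ≤ μ (ballH x r) ∧
    μ (ballH x r) ≤ ((b : ℝ).toNNReal : ℝ≥0∞) * ENNReal.ofReal (r ^ s)} with hGdef
  have hae : ∀ᵐ x ∂μ, ∀ (a b : ℚ) (l k : ℕ), x ∈ G a b l →
      ∀ᶠ r in nhdsWithin (0 : ℝ) (Ioi 0),
        μ.restrict (toMeasurable μ (G a b l))ᶜ (ballH x r) ≤
          ((1 / ((k : ℝ≥0) + 1) : ℝ≥0) : ℝ≥0∞) * ENNReal.ofReal (r ^ s) := by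
    simp only [ae_all_iff]
    intro a b l k
    have h0 : μ.restrict (toMeasurable μ (G a b l))ᶜ (G a b l) = 0 := by
      refine measure_mono_null (subset_toMeasurable μ _) ?_
      rw [Measure.restrict_apply (measurableSet_toMeasurable _ _), inter_compl_self, measure_empty]
    have := density_null (μ := μ) (s := s) h0 (M := (b : ℝ).toNNReal)
      (ρ := 1 / ((l : ℝ) + 1)) (by positivity) (fun x hx r hr hr2 => (hx r hr hr2).2)
      (t := 1 / ((k : ℝ≥0) + 1)) (by positivity)
    rw [ae_iff]
    refine measure_mono_null (fun x hx => ?_) this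
    have hx' := _root_.not_imp.1 hx
    exact ⟨hx'.1, hx'.2⟩
  obtain ⟨x, ⟨d, hd0, hdt, hd⟩, hx⟩ := ((frequently_ae_mem_iff.2 h.ne').and_eventually hae).exists
  refine blowup μ x d hd0 hdt hd fun a b ha hb => ?_
  obtain ⟨qa, -, ha1, ha2⟩ := ENNReal.lt_iff_exists_rat_btwn.1 ha
  obtain ⟨qb, -, hb1, hb2⟩ := ENNReal.lt_iff_exists_rat_btwn.1 hb
  have hev : ∀ᶠ r in nhdsWithin (0 : ℝ) (Ioi 0),
      ((qa : ℝ).toNNReal : ℝ≥0∞) * ENNReal.ofReal (r ^ s) ≤ μ (ballH x r) ∧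
      μ (ballH x r) ≤ ((qb : ℝ).toNNReal : ℝ≥0∞) * ENNReal.ofReal (r ^ s) := by
    filter_upwards [hd.eventually (Ioo_mem_nhds ha2 hb1), eventually_mem_nhdsWithin] with r hr hr0
    have hr0' : ENNReal.ofReal (r ^ s) ≠ 0 := by
      have := Real.rpow_pos_of_pos (show 0 < r from hr0) s
      simpa using this
    exact ⟨(ENNReal.le_div_iff_mul_le (Or.inl hr0') (Or.inl ENNReal.ofReal_ne_top)).1 hr.1.le,
      (ENNReal.div_le_iff_le_mul (Or.inl hr0') (Or.inl ENNReal.ofReal_ne_top)).1 hr.2.le⟩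
  obtain ⟨ε, hε, hsub⟩ := mem_nhdsGT_iff_exists_Ioo_subset.1 hev
  obtain ⟨l, hl⟩ := exists_nat_one_div_lt (show (0 : ℝ) < ε from hε)
  have hxG : x ∈ G qa qb l := fun r hr hr2 => hsub ⟨hr, hr2.trans hl⟩
  refine ⟨G qa qb l, 1 / ((l : ℝ) + 1), by positivity, fun z hz r hr hr2 => ?_, fun t ht => ?_⟩
  · obtain ⟨h1, h2⟩ := hz r hr hr2
    exact ⟨le_trans (by gcongr) h1, h2.trans (by gcongr)⟩
  · obtain ⟨k, hk⟩ := exists_nat_one_div_lt ht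
    filter_upwards [hx qa qb l k hxG] with r hr
    rw [Measure.restrict_apply (isClosed_ballH x r).measurableSet] at hr
    rw [sdiff_eq]
    refine hr.trans ?_
    gcongr
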